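/- arXiv:0712.3417 — 4 statements merged into one kernel-verified Lean document; each statement's English description precedes it below -/
import Mathlib

section
/- Let X be an obtuse random variable in ℝ^N defined on the finite probability space A = {0,1,...,N} with P({i}) = p_i > 0. Then the N+1 random variables X^0, X^1, ..., X^N (where X^0 is the constant random variable 1 and X^1,...,X^N are the coordinates of X) form an orthonormal basis of the complex Hilbert space L²(A, 𝒜, P). -/
open scoped BigOperators

/-- A family of functions that is orthonormal for a weighted sesquilinear form is linearly
independent. -/
theorem linearIndependent_of_weighted_orthonormal {ι α : Type*} [Fintype ι] [DecidableEq ι]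
    [Fintype α] (w : α → ℂ) (Y : ι → α → ℂ)
    (h : ∀ i j, ∑ a, w a * starRingEnd ℂ (Y i a) * Y j a = if i = j then 1 else 0) :
    LinearIndependent ℂ Y := by
  rw [Fintype.linearIndependent_iff]
  intro g hg i
  calc g i = ∑ j, g j * ∑ a, w a * starRingEnd ℂ (Y i a) * Y j a := by simp [h]
    _ = ∑ a, w a * starRingEnd ℂ (Y i a) * (∑ j, g j • Y j) a := by
      simp only [Finset.mul_sum, Finset.sum_apply, Pi.smul_apply, smul_eq_mul]
      rw [Finset.sum_comm]
      exact Finset.sum_congr rfl fun a _ => Finset.sum_congr rfl fun j _ => by ring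
    _ = 0 := by simp only [hg, Pi.zero_apply, mul_zero, Finset.sum_const_zero]

/-- For an obtuse random variable `X` in `ℝ^N` (centered and normalized, on the finite
probability space `A = {0,…,N}` with `P({i}) = p i > 0`), the `N+1` random variables
`X⁰ ≡ 1, X¹, …, X^N` form an orthonormal basis of the complex Hilbert space `L²(A, 𝒜, P)`,
whose inner product is `⟨f, g⟩ = ∑ a, p a * conj (f a) * g a`: they are orthonormal for
this inner product and they span the whole space of complex functions on `A`. -/
theorem statement1 (N : ℕ)
    (p : Fin (N + 1) → ℝ) (hp : ∀ i, 0 < p i) (hpsum : ∑ i, p i = 1)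
    (v : Fin (N + 1) → Fin N → ℝ)
    (hcent : ∀ k, ∑ i, p i * v i k = 0)
    (hnorm : ∀ k l, ∑ i, p i * v i k * v i l = if k = l then 1 else 0)
    (Y : Fin (N + 1) → Fin (N + 1) → ℂ)
    (hY : ∀ i a, Y i a = ((Fin.cons (α := fun _ => ℝ) 1 (v a) i : ℝ) : ℂ)) :
    (∀ i j, ∑ a, (p a : ℂ) * starRingEnd ℂ (Y i a) * Y j a = if i = j then 1 else 0) ∧
      Submodule.span ℂ (Set.range Y) = ⊤ := by
  have hreal : ∀ i j, ∑ a, p a * (Fin.cons (α := fun _ => ℝ) 1 (v a) i : ℝ) *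
      (Fin.cons (α := fun _ => ℝ) 1 (v a) j : ℝ) = if i = j then 1 else 0 := by
    intro i j
    cases i using Fin.cases <;> cases j using Fin.cases <;>
      simp [hpsum, hcent, hnorm, Fin.succ_ne_zero, (Fin.succ_ne_zero _).symm]
  have horth : ∀ i j, ∑ a, (p a : ℂ) * starRingEnd ℂ (Y i a) * Y j a =
      if i = j then 1 else 0 := by
    intro i j
    simp only [hY, Complex.conj_ofReal]
    simpa [apply_ite Complex.ofReal] using congrArg Complex.ofReal (hreal i j)
  exact ⟨horth, (linearIndependent_of_weighted_orthonormal _ Y horth).span_eq_top_of_card_eq_finrank'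
    (by simp)⟩
end

section
/- Let X be an obtuse random variable in ℝ^N, i.e., a centered and normalized random variable on the finite probability space A = {0,1,...,N} (with all p_i > 0) taking exactly N+1 values. Then there exists a sesqui-symmetric 3-tensor T = (T^{ij}_k)_{i,j,k ∈ {1,...,N}} of real coefficients such that for all i, j ∈ {1,...,N}, the pointwise product of coordinate random variables satisfies X^i X^j = δ_{ij}·1 + Σ_{k=1}^N T^{ij}_k X^k (equivalently, X ⊗ X = I + T(X)). -/
open scoped BigOperators

/-- The coordinates of an obtuse random variable together with the constant `1` form an
orthonormal basis of `L²`, so every function on the probability space equals its expansion. -/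
theorem obtuse_expansion {N : ℕ}
    (p : Fin (N + 1) → ℝ) (hpsum : ∑ i, p i = 1) (v : Fin (N + 1) → Fin N → ℝ)
    (hcent : ∀ k, ∑ i, p i * v i k = 0)
    (hnorm : ∀ k l, ∑ i, p i * v i k * v i l = if k = l then 1 else 0)
    (f : Fin (N + 1) → ℝ) (a : Fin (N + 1)) :
    f a = ∑ b, p b * f b + ∑ k, (∑ b, p b * f b * v b k) * v a k := by
  let e : Fin (N + 1) → Fin (N + 1) → ℝ := fun a => Fin.cons 1 (v a)
  have horth : (Matrix.of fun k a => e a k) * (Matrix.of fun a k => p a * e a k) = 1 := by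
    ext k l
    simp only [Matrix.mul_apply, Matrix.of_apply, Matrix.one_apply]
    refine Fin.cases ?_ (fun k => ?_) k <;> refine Fin.cases ?_ (fun l => ?_) l
    · simpa [e] using hpsum
    · simpa [e, (Fin.succ_ne_zero l).symm] using hcent l
    · simpa [e, mul_comm] using hcent k
    · simp only [e, Fin.cons_succ, Fin.succ_inj, ← hnorm k l]
      exact Finset.sum_congr rfl fun b _ => by ring
  have hcomplete (b : Fin (N + 1)) :
      p b * (1 + ∑ k, v b k * v a k) = if b = a then 1 else 0 := by
    have h := Matrix.ext_iff.mpr (mul_eq_one_comm.mp horth) b a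
    simp only [Matrix.mul_apply, Matrix.of_apply, Matrix.one_apply] at h
    rw [← h, Fin.sum_univ_succ]
    simp [e, mul_add, Finset.mul_sum, mul_assoc]
  calc
    f a = ∑ b, f b * (p b * (1 + ∑ k, v b k * v a k)) := by simp [hcomplete]
    _ = ∑ b, p b * f b + ∑ k, (∑ b, p b * f b * v b k) * v a k := by
      simp only [Finset.sum_mul]
      rw [Finset.sum_comm, ← Finset.sum_add_distrib]
      refine Finset.sum_congr rfl fun b _ => ?_
      rw [mul_add, mul_add, Finset.mul_sum, Finset.mul_sum]
      congr 1
      · ring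
      · exact Finset.sum_congr rfl fun k _ => by ring

/-- If `X` is a centered and normalized random variable in `ℝ^N` taking exactly `N+1`
values `v 0, …, v N` (with probabilities `p i > 0`), then there exists a sesqui-symmetric
3-tensor `T` such that `Xⁱ Xʲ = δ_{ij} + ∑ k, T i j k * Xᵏ` pointwise, i.e.
`X ⊗ X = I + T(X)`.  Sesqui-symmetry: (i) `(i,j,k) ↦ T i j k` is symmetric under all
permutations; (ii) `(i,j,l,m) ↦ ∑ k, T i j k * T l m k + δ_{ij} δ_{lm}` is symmetric
under all permutations. -/
theorem statement2 (N : ℕ)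
    (p : Fin (N + 1) → ℝ) (hp : ∀ i, 0 < p i) (hpsum : ∑ i, p i = 1)
    (v : Fin (N + 1) → Fin N → ℝ) (hinj : Function.Injective v)
    (hcent : ∀ k, ∑ i, p i * v i k = 0)
    (hnorm : ∀ k l, ∑ i, p i * v i k * v i l = if k = l then 1 else 0) :
    ∃ T : Fin N → Fin N → Fin N → ℝ,
      -- (i) full symmetry of (i,j,k) ↦ T i j k
      (∀ (x : Fin 3 → Fin N) (σ : Equiv.Perm (Fin 3)),
        T (x 0) (x 1) (x 2) = T (x (σ 0)) (x (σ 1)) (x (σ 2))) ∧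
      -- (ii) full symmetry of (i,j,l,m) ↦ ∑ k, T i j k * T l m k + δ_{ij} δ_{lm}
      (∀ (x : Fin 4 → Fin N) (σ : Equiv.Perm (Fin 4)),
        (∑ k, T (x 0) (x 1) k * T (x 2) (x 3) k) +
            (if x 0 = x 1 then (1 : ℝ) else 0) * (if x 2 = x 3 then 1 else 0) =
          (∑ k, T (x (σ 0)) (x (σ 1)) k * T (x (σ 2)) (x (σ 3)) k) +
            (if x (σ 0) = x (σ 1) then (1 : ℝ) else 0) *
              (if x (σ 2) = x (σ 3) then 1 else 0)) ∧
      -- the representation `X ⊗ X = I + T(X)`, pointwise on `A`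
      ∀ i j a, v a i * v a j = (if i = j then 1 else 0) + ∑ k, T i j k * v a k := by
  have hrep (i j : Fin N) (a : Fin (N + 1)) : v a i * v a j =
      (if i = j then 1 else 0) + ∑ k, (∑ b, p b * v b i * v b j * v b k) * v a k := by
    simpa only [← mul_assoc, hnorm] using
      obtuse_expansion p hpsum v hcent hnorm (fun b => v b i * v b j) a
  have hmoment (i j l m : Fin N) :
      (∑ k, (∑ b, p b * v b i * v b j * v b k) * (∑ b, p b * v b l * v b m * v b k)) +
        (if i = j then (1 : ℝ) else 0) * (if l = m then 1 else 0) =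
      ∑ b, p b * (v b i * v b j * v b l * v b m) := by
    symm
    calc
      ∑ b, p b * (v b i * v b j * v b l * v b m)
          = ∑ b, p b * v b l * v b m * ((if i = j then 1 else 0) +
              ∑ k, (∑ c, p c * v c i * v c j * v c k) * v b k) :=
        Finset.sum_congr rfl fun b _ => by rw [← hrep]; ring
      _ = _ := by
        simp only [mul_add, Finset.sum_add_distrib, ← Finset.sum_mul, hnorm]
        rw [add_comm, mul_comm (if l = m then (1 : ℝ) else 0)]
        congr 1
        simp only [Finset.mul_sum (s := Finset.univ (α := Fin N))]
        rw [Finset.sum_comm]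
        refine Finset.sum_congr rfl fun k _ => ?_
        rw [Finset.mul_sum]
        exact Finset.sum_congr rfl fun b _ => by ring
  refine ⟨fun i j k => ∑ b, p b * v b i * v b j * v b k, fun x σ => ?_, fun x σ => ?_, hrep⟩
  · refine Finset.sum_congr rfl fun b _ => ?_
    have h := Equiv.prod_comp σ fun s => v b (x s)
    simp only [Fin.prod_univ_three] at h
    linear_combination -p b * h
  · simp only [hmoment]
    refine Finset.sum_congr rfl fun b _ => ?_
    have h := Equiv.prod_comp σ fun s => v b (x s)
    simp only [Fin.prod_univ_four] at h
    rw [h]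
end

section
/- Let X be an obtuse random variable in ℝ^N on the finite probability space A = {0,1,...,N} with P({i}) = p_i > 0, with coordinate random variables X^1,...,X^N and X^0 ≡ 1. Consider the infinite product probability space (A^ℕ, 𝒜^⊗ℕ, P^⊗ℕ). For each finitely supported sequence σ : ℕ → {0,1,...,N} (i.e., σ(p) ≠ 0 for only finitely many p), define the random variable X_σ(ω) = Π_{p : σ(p) ≠ 0} X^{σ(p)}(ω(p)). Then the family {X_σ : σ finitely supported} is an orthonormal (Hilbert) basis of L²(A^ℕ, 𝒜^⊗ℕ, P^⊗ℕ). -/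
open MeasureTheory
open scoped BigOperators

open Finset in
/-- A product over the support of a finitely supported sequence, extended to any initial segment
containing the support when the value at `0` is `1`. -/
lemma prod_support_eq_prod_fin {A : Type*} [Zero A] {M : Type*} [CommMonoid M]
    (g : ℕ → A → M) (hg : ∀ t, g t 0 = 1) (σ : ℕ →₀ A) {n : ℕ} (hn : σ.support ⊆ range n) :
    ∏ t ∈ σ.support, g t (σ t) = ∏ i : Fin n, g i (σ i) := by
  rw [← Finset.prod_range (fun t => g t (σ t))]
  refine Finset.prod_subset hn fun t _ ht => ?_
  rw [Finsupp.notMem_support_iff.1 ht, hg]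

/-- The finitely supported sequence extending a finite word by zeros. -/
noncomputable def wordExtend {A : Type*} [Zero A] {n : ℕ} (s : Fin n → A) : ℕ →₀ A :=
  Finsupp.embDomain Fin.valEmbedding (Finsupp.equivFunOnFinite.symm s)

lemma wordExtend_apply {A : Type*} [Zero A] {n : ℕ} (s : Fin n → A) (i : Fin n) :
    wordExtend s i = s i :=
  Finsupp.embDomain_apply_self Fin.valEmbedding _ i

lemma support_wordExtend_subset {A : Type*} [Zero A] {n : ℕ} (s : Fin n → A) :
    (wordExtend s).support ⊆ Finset.range n := by
  intro t ht
  rw [wordExtend, Finsupp.support_embDomain, Finset.mem_map] at ht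
  obtain ⟨i, -, rfl⟩ := ht
  simp

/-- The coordinates of an obtuse random variable, together with the constant `1`, are
orthonormal. -/
lemma obtuse_sum_mul_mul {N : ℕ} {p : Fin (N + 1) → ℝ} (hpsum : ∑ i, p i = 1)
    {v : Fin (N + 1) → Fin N → ℝ} (hcent : ∀ k, ∑ i, p i * v i k = 0)
    (hnorm : ∀ k l, ∑ i, p i * v i k * v i l = if k = l then 1 else 0)
    {w : Fin (N + 1) → Fin (N + 1) → ℝ}
    (hw : ∀ a, w a = Fin.cons (α := fun _ => ℝ) 1 (v a)) (i j : Fin (N + 1)) :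
    ∑ a, p a * w a i * w a j = if i = j then 1 else 0 := by
  refine Fin.cases ?_ (fun k => ?_) i <;> refine Fin.cases ?_ (fun l => ?_) j
  · simpa [hw] using hpsum
  · simpa [hw, (Fin.succ_ne_zero l).symm] using hcent l
  · simpa [hw, Fin.succ_ne_zero k] using hcent k
  · simpa [hw] using hnorm k l

/-- Row orthogonality deduced from column orthogonality with weights `p`. -/
lemma sum_mul_mul_of_orthonormal {ι : Type*} [Fintype ι] [DecidableEq ι] {p : ι → ℝ}
    {w : ι → ι → ℝ} (h : ∀ i j, ∑ a, p a * w a i * w a j = if i = j then 1 else 0) (a b : ι) :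
    ∑ i, p b * w b i * w a i = if a = b then 1 else 0 := by
  have h1 : (Matrix.of fun i a => p a * w a i) * Matrix.of w = 1 := by
    ext i j
    simpa [Matrix.mul_apply, Matrix.one_apply] using h i j
  have h2 : (Matrix.of w * Matrix.of fun i a => p a * w a i) a b = (1 : Matrix ι ι ℝ) a b := by
    rw [mul_eq_one_comm.1 h1]
  rw [Matrix.mul_apply, Matrix.one_apply] at h2
  rw [← h2]
  exact Finset.sum_congr rfl fun i _ => by simp [mul_comm]

/-- The integral of a function of the first `n` coordinates, for a product measure given by its
values on cylinders. -/
lemma integral_comp_fin_coords {A : Type*} [Fintype A] [MeasurableSpace A]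
    [MeasurableSingletonClass A] {p : A → ℝ} (hp : ∀ i, 0 < p i)
    {μ : Measure (ℕ → A)} [IsProbabilityMeasure μ]
    (hμ : ∀ (m : ℕ) (y : Fin m → A),
      μ {ω | ∀ i : Fin m, ω i = y i} = ∏ i, ENNReal.ofReal (p (y i)))
    {n : ℕ} (F : (Fin n → A) → ℝ) :
    ∫ ω, F (fun i => ω i) ∂μ = ∑ y, (∏ i, p (y i)) * F y := by
  have hm : Measurable fun (ω : ℕ → A) (i : Fin n) => ω i :=
    measurable_pi_lambda _ fun i => measurable_pi_apply _
  have := Measure.isProbabilityMeasure_map (μ := μ) hm.aemeasurable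
  rw [← integral_map (f := F) hm.aemeasurable (measurable_of_finite F).aestronglyMeasurable,
    integral_fintype Integrable.of_finite]
  refine Finset.sum_congr rfl fun y _ => ?_
  rw [smul_eq_mul, Measure.real, Measure.map_apply hm (measurableSet_singleton y)]
  have hset : (fun (ω : ℕ → A) (i : Fin n) => ω i) ⁻¹' {y} = {ω | ∀ i : Fin n, ω i = y i} := by
    ext ω
    simp [funext_iff]
  rw [hset, hμ, ENNReal.toReal_prod]
  simp only [ENNReal.toReal_ofReal (hp _).le]

/-- Every function of a finite word is a linear combination of products of the functions `w`. -/
lemma exists_eq_sum_prod {ι : Type*} [Fintype ι] [DecidableEq ι] {p : ι → ℝ}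
    {w : ι → ι → ℝ} (h : ∀ a b, ∑ i, p b * w b i * w a i = if a = b then 1 else 0)
    {n : ℕ} (F : (Fin n → ι) → ℝ) :
    ∃ c : (Fin n → ι) → ℝ, ∀ x, F x = ∑ s, c s * ∏ t, w (x t) (s t) := by
  refine ⟨fun s => ∑ y, F y * ∏ t, p (y t) * w (y t) (s t), fun x => ?_⟩
  have hδ : ∀ y : Fin n → ι, ∑ s : Fin n → ι, ∏ t, p (y t) * w (y t) (s t) * w (x t) (s t)
      = if x = y then 1 else 0 := by
    intro y
    rw [← Fintype.prod_sum (fun t i => p (y t) * w (y t) i * w (x t) i)]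
    simp only [h, Fintype.prod_boole, funext_iff]
    congr
  simp only [Finset.sum_mul]
  rw [Finset.sum_comm]
  simp only [mul_assoc, ← Finset.mul_sum, ← Finset.prod_mul_distrib] at hδ ⊢
  simp [hδ]

/-- An integrable function on `A^ℕ` whose integral against every function of finitely many
coordinates vanishes is almost everywhere zero. -/
lemma ae_eq_zero_of_forall_integral_fin_coords {A : Type*} [MeasurableSpace A]
    {μ : Measure (ℕ → A)} {g : (ℕ → A) → ℂ} (hg : Integrable g μ)
    (h : ∀ (n : ℕ) (F : (Fin n → A) → ℝ), ∫ ω, (F (fun i => ω i) : ℂ) * g ω ∂μ = 0) :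
    g =ᵐ[μ] 0 := by
  have htot : ∫ ω, g ω ∂μ = 0 := by simpa using h 0 fun _ => 1
  refine hg.ae_eq_zero_of_forall_setIntegral_eq_zero fun s hs hfin => ?_
  clear hfin
  induction s, hs using MeasurableSpace.induction_on_inter
    (generateFrom_measurableCylinders (α := fun _ : ℕ => A)).symm
    isPiSystem_measurableCylinders with
  | empty => simp
  | basic t ht =>
    obtain ⟨s, S, hS, rfl⟩ := (mem_measurableCylinders t).1 ht
    obtain ⟨n, hn⟩ := s.exists_nat_subset_range
    classical
    have hlt : ∀ i : s, (i : ℕ) < n := fun i => Finset.mem_range.1 (hn i.2)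
    have key := h n fun x => if (fun i : s => x ⟨i, hlt i⟩) ∈ S then 1 else 0
    rw [← integral_indicator (hS.cylinder s), ← key]
    refine integral_congr_ae (.of_forall fun ω => ?_)
    have hmem : ω ∈ cylinder s S ↔ (fun i : s => ω i) ∈ S := Iff.rfl
    by_cases hω : (fun i : s => ω i) ∈ S
    · simp [Set.indicator, hmem, hω]
    · simp [Set.indicator, hmem, hω]
  | compl t ht ih =>
    have := integral_add_compl ht hg
    rwa [ih, htot, zero_add] at this
  | iUnion t hd ht ih =>
    rw [integral_iUnion ht hd hg.integrableOn]
    simp [ih]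

/-- Proposition (`P:base`): let `X` be an obtuse random variable in `ℝ^N` on
`A = {0,…,N}` with `P({i}) = p i > 0`, with coordinates `X¹,…,X^N` and `X⁰ ≡ 1`
(encoded by `w a = Fin.cons 1 (v a)`, so that `Xⁱ(a) = w a i`).  Let `μ` be the infinite
product measure `P^{⊗ℕ}` on `A^ℕ` (characterized by its values on cylinder sets).  For
every finitely supported `σ : ℕ →₀ Fin (N+1)` let `f σ ∈ L²(μ)` be (the class of) the
random variable `X_σ(ω) = ∏_{t ∈ supp σ} X^{σ t}(ω t)`.  Then the family `(f σ)_σ` is an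
orthonormal basis of the Hilbert space `L²(A^ℕ, 𝒜^{⊗ℕ}, P^{⊗ℕ})`: it is orthonormal and
its linear span is dense. -/
theorem statement4 (N : ℕ)
    (p : Fin (N + 1) → ℝ) (hp : ∀ i, 0 < p i) (hpsum : ∑ i, p i = 1)
    (v : Fin (N + 1) → Fin N → ℝ)
    (hcent : ∀ k, ∑ i, p i * v i k = 0)
    (hnorm : ∀ k l, ∑ i, p i * v i k * v i l = if k = l then 1 else 0)
    (w : Fin (N + 1) → Fin (N + 1) → ℝ)
    (hw : ∀ a, w a = Fin.cons (α := fun _ => ℝ) 1 (v a))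
    (μ : Measure (ℕ → Fin (N + 1))) [IsProbabilityMeasure μ]
    (hμ : ∀ (m : ℕ) (y : Fin m → Fin (N + 1)),
      μ {ω | ∀ i : Fin m, ω i = y i} = ∏ i, ENNReal.ofReal (p (y i)))
    (f : (ℕ →₀ Fin (N + 1)) → Lp ℂ 2 μ)
    (hf : ∀ σ : ℕ →₀ Fin (N + 1),
      (f σ : (ℕ → Fin (N + 1)) → ℂ) =ᵐ[μ]
        fun ω => ((∏ t ∈ σ.support, w (ω t) (σ t) : ℝ) : ℂ)) :
    Orthonormal ℂ f ∧ (Submodule.span ℂ (Set.range f)).topologicalClosure = ⊤ := by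
  have hcol := obtuse_sum_mul_mul hpsum hcent hnorm hw
  have hrow := sum_mul_mul_of_orthonormal hcol
  have hw0 : ∀ a, w a 0 = 1 := fun a => by simp [hw]
  have hX : ∀ (σ : ℕ →₀ Fin (N + 1)) {n : ℕ}, σ.support ⊆ Finset.range n →
      ∀ᵐ ω ∂μ, f σ ω = ((∏ i : Fin n, w (ω i) (σ i) : ℝ) : ℂ) := fun σ n hn => by
    filter_upwards [hf σ] with ω hω
    rw [hω, prod_support_eq_prod_fin (fun t a => w (ω t) a) (fun t => hw0 _) σ hn]
  constructor
  · rw [orthonormal_iff_ite]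
    intro σ τ
    obtain ⟨n, hn⟩ := (σ.support ∪ τ.support).exists_nat_subset_range
    have hσ := Finset.union_subset_left hn
    have hτ := Finset.union_subset_right hn
    have hinner : inner ℂ (f σ) (f τ)
        = ((∫ ω, ∏ i : Fin n, w (ω i) (σ i) * w (ω i) (τ i) ∂μ : ℝ) : ℂ) := by
      rw [L2.inner_def, ← integral_complex_ofReal]
      refine integral_congr_ae ?_
      filter_upwards [hX σ hσ, hX τ hτ] with ω h1 h2
      rw [h1, h2, RCLike.inner_apply, Complex.conj_ofReal, Finset.prod_mul_distrib, mul_comm,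
        Complex.ofReal_mul]
    rw [hinner, integral_comp_fin_coords hp hμ
      (fun y : Fin n → Fin (N + 1) => ∏ i, w (y i) (σ i) * w (y i) (τ i))]
    simp only [← Finset.prod_mul_distrib, ← mul_assoc]
    rw [← Fintype.prod_sum (fun (i : Fin n) a => p a * w a (σ i) * w a (τ i))]
    simp only [hcol, Fintype.prod_boole]
    have hiff : (∀ i : Fin n, σ i = τ i) ↔ σ = τ := by
      refine ⟨fun h => Finsupp.ext fun t => ?_, fun h i => by rw [h]⟩
      by_cases ht : t < n
      · exact h ⟨t, ht⟩
      · have ht' : t ∉ Finset.range n := by simpa using ht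
        rw [Finsupp.notMem_support_iff.1 fun h => ht' (hσ h),
          Finsupp.notMem_support_iff.1 fun h => ht' (hτ h)]
    simp only [hiff]
    split_ifs <;> simp
  · rw [Submodule.topologicalClosure_eq_top_iff, Submodule.eq_bot_iff]
    intro g hg
    have hgi : Integrable g μ := (Lp.memLp g).integrable (by norm_num)
    have horth : ∀ {n : ℕ} (s : Fin n → Fin (N + 1)),
        Integrable (fun ω => ((∏ i : Fin n, w (ω i) (s i) : ℝ) : ℂ) * g ω) μ ∧
          ∫ ω, ((∏ i : Fin n, w (ω i) (s i) : ℝ) : ℂ) * g ω ∂μ = 0 := by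
      intro n s
      have h0 : inner ℂ (f (wordExtend s)) g = 0 :=
        (Submodule.mem_orthogonal _ _).1 hg _ (Submodule.subset_span ⟨_, rfl⟩)
      have hae : (fun ω => inner ℂ (f (wordExtend s) ω) (g ω)) =ᵐ[μ]
          fun ω => ((∏ i : Fin n, w (ω i) (s i) : ℝ) : ℂ) * g ω := by
        filter_upwards [hX _ (support_wordExtend_subset s)] with ω hω
        simp only [wordExtend_apply] at hω
        rw [hω, RCLike.inner_apply, Complex.conj_ofReal, mul_comm]
      exact ⟨(L2.integrable_inner (𝕜 := ℂ) (f (wordExtend s)) g).congr hae,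
        by rw [← integral_congr_ae hae, ← L2.inner_def, h0]⟩
    refine (Lp.eq_zero_iff_ae_eq_zero).2
      (ae_eq_zero_of_forall_integral_fin_coords hgi fun n F => ?_)
    obtain ⟨c, hc⟩ := exists_eq_sum_prod hrow F
    have hexp : ∀ ω : ℕ → Fin (N + 1), (F (fun i => ω i) : ℂ) * g ω
        = ∑ s : Fin n → Fin (N + 1), (c s : ℂ) * (((∏ i : Fin n, w (ω i) (s i) : ℝ) : ℂ) * g ω) := by
      intro ω
      rw [hc, Complex.ofReal_sum, Finset.sum_mul]
      simp only [Complex.ofReal_mul, mul_assoc]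
    simp only [hexp]
    rw [integral_finsetSum _ fun s _ => (horth s).1.const_mul _]
    simp only [integral_const_mul, (horth _).2, mul_zero, Finset.sum_const_zero]
end

section
/- Let X be an obtuse random variable in ℝ^N with values v_0,...,v_N, probabilities p_i, and extended 3-tensor T. Let B_0,...,B_N ∈ M_n(ℂ) and define U^i_j = Σ_{k=0}^N T^{ij}_k B_k for i,j ∈ {0,...,N}. Suppose the block operator U = Σ_{i,j=0}^N U^i_j ⊗ E^i_j on ℂ^n ⊗ ℂ^{N+1} is unitary, i.e., Σ_{k=0}^N (U^k_i)* U^k_j = δ_{ij} I_n and Σ_{k=0}^N U^k_j (U^k_i)* = δ_{ij} I_n for all i, j. Then for every l ∈ {0,1,...,N}, the operator W_l = Σ_{i=0}^N v_l^i B_i (with the convention v_l^0 = 1, and v_l^i the i-th coordinate of v_l for i ≥ 1) is unitary. -/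
open Matrix
open scoped BigOperators

/-- The structure tensor of an orthonormal family of functions on a weighted finite set
consists of the third moments of the family. -/
lemma structureTensor_eq_thirdMoment {α ι : Type*} [Fintype α] [Fintype ι] [DecidableEq ι]
    {p : α → ℝ} {w : α → ι → ℝ} {S : ι → ι → ι → ℝ}
    (horth : ∀ i j, ∑ a, p a * (w a i * w a j) = if i = j then 1 else 0)
    (hmul : ∀ a i j, w a i * w a j = ∑ m, S i j m * w a m) (i j k : ι) :
    S i j k = ∑ a, p a * (w a i * w a j * w a k) := by
  calc S i j k = ∑ m, S i j m * ∑ a, p a * (w a m * w a k) := by simp [horth]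
    _ = ∑ a, p a * ((∑ m, S i j m * w a m) * w a k) := by
      simp only [Finset.mul_sum, Finset.sum_mul]
      rw [Finset.sum_comm]
      exact Finset.sum_congr rfl fun a _ => Finset.sum_congr rfl fun m _ => by ring
    _ = _ := by simp only [← hmul]

/-- If the columns of a block matrix `U` are orthonormal and a nonzero real vector `x` satisfies
`∑ j, x j • U i j = x i • W` for all `i`, then `W` is unitary. -/
lemma mem_unitaryGroup_of_block_eigenvector {ι m : Type*} [Fintype ι] [DecidableEq ι]
    [Fintype m] [DecidableEq m] {U : ι → ι → Matrix m m ℂ} {W : Matrix m m ℂ} {x : ι → ℝ}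
    (hx : x ≠ 0)
    (hU : ∀ i j, ∑ k, (U k i)ᴴ * U k j = if i = j then (1 : Matrix m m ℂ) else 0)
    (hW : ∀ i, ∑ j, (x j : ℂ) • U i j = (x i : ℂ) • W) :
    W ∈ Matrix.unitaryGroup m ℂ := by
  set c : ℂ := ∑ i, (x i : ℂ) * x i with hc
  have hc0 : c ≠ 0 := by
    obtain ⟨i, hi⟩ := Function.ne_iff.mp hx
    have hpos : 0 < ∑ i, x i * x i :=
      Finset.sum_pos' (fun i _ => mul_self_nonneg (x i))
        ⟨i, Finset.mem_univ i, mul_self_pos.mpr hi⟩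
    rw [hc]
    exact_mod_cast hpos.ne'
  have hleft : ∑ k, (∑ i, (x i : ℂ) • U k i)ᴴ * ∑ j, (x j : ℂ) • U k j = c • (Wᴴ * W) := by
    simp only [hW, conjTranspose_smul, smul_mul_smul_comm, hc, Finset.sum_smul]
    simp
  have hright : ∑ k, (∑ i, (x i : ℂ) • U k i)ᴴ * ∑ j, (x j : ℂ) • U k j
      = c • (1 : Matrix m m ℂ) := by
    calc _ = ∑ i, ∑ j, ((x i : ℂ) * x j) • ∑ k, (U k i)ᴴ * U k j := by
          simp only [conjTranspose_sum, conjTranspose_smul, Finset.sum_mul_sum,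
            smul_mul_smul_comm, Finset.smul_sum]
          rw [Finset.sum_comm]
          refine Finset.sum_congr rfl fun i _ => ?_
          rw [Finset.sum_comm]
          simp
      _ = _ := by simp [hU, hc, Finset.sum_smul]
  rw [Matrix.mem_unitaryGroup_iff', star_eq_conjTranspose]
  exact smul_right_injective _ hc0 (hleft.symm.trans hright)

/-- Proposition (`first sens`): let `X` be an obtuse random variable in `ℝ^N` with values
`v 0,…,v N` (extended coordinates `w l = Fin.cons 1 (v l)`, so `w l 0 = 1`) and extended
3-tensor `Text`.  Let `B 0,…,B N ∈ M_n(ℂ)` and `Uⁱⱼ = ∑ k, T^{ij}_k • B k`.  If the block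
operator `U = ∑ Uⁱⱼ ⊗ Eⁱⱼ` is unitary, i.e. `∑ k, (Uᵏᵢ)* Uᵏⱼ = δ_{ij} I` and
`∑ k, Uᵏⱼ (Uᵏᵢ)* = δ_{ij} I`, then each `W l = ∑ i, w l i • B i` is unitary. -/
theorem statement7 (N n : ℕ)
    (p : Fin (N + 1) → ℝ) (hp : ∀ i, 0 < p i) (hpsum : ∑ i, p i = 1)
    (v : Fin (N + 1) → Fin N → ℝ)
    (hcent : ∀ k, ∑ i, p i * v i k = 0)
    (hnorm : ∀ k l, ∑ i, p i * v i k * v i l = if k = l then 1 else 0)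
    (hobt : ∀ i j, i ≠ j → ∑ k, v i k * v j k = -1)
    (hpform : ∀ i, p i = 1 / (1 + ∑ k, v i k ^ 2))
    (w : Fin (N + 1) → Fin (N + 1) → ℝ)
    (hw : ∀ a, w a = Fin.cons (α := fun _ => ℝ) 1 (v a))
    (T : Fin N → Fin N → Fin N → ℝ)
    (hT : ∀ i j a, v a i * v a j = (if i = j then 1 else 0) + ∑ k, T i j k * v a k)
    (Text : Fin (N + 1) → Fin (N + 1) → Fin (N + 1) → ℝ)
    (hText0 : ∀ i j, Text i j 0 = if i = j then 1 else 0)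
    (hText1 : ∀ i j, Text i 0 j = if i = j then 1 else 0)
    (hText2 : ∀ i j, Text 0 i j = if i = j then 1 else 0)
    (hTexts : ∀ i j k : Fin N, Text i.succ j.succ k.succ = T i j k)
    (B : Fin (N + 1) → Matrix (Fin n) (Fin n) ℂ)
    (U : Fin (N + 1) → Fin (N + 1) → Matrix (Fin n) (Fin n) ℂ)
    (hU : ∀ i j, U i j = ∑ k, (Text i j k : ℂ) • B k)
    (hU1 : ∀ i j, ∑ k, (U k i)ᴴ * U k j =
      if i = j then (1 : Matrix (Fin n) (Fin n) ℂ) else 0)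
    (hU2 : ∀ i j, ∑ k, U k j * (U k i)ᴴ =
      if i = j then (1 : Matrix (Fin n) (Fin n) ℂ) else 0) :
    ∀ l, (∑ i, ((w l i : ℝ) : ℂ) • B i) ∈ Matrix.unitaryGroup (Fin n) ℂ := by
  have hw0 : ∀ a, w a 0 = 1 := fun a => by simp [hw]
  have hws : ∀ a i, w a (Fin.succ i) = v a i := fun a i => by simp [hw]
  have horth : ∀ i j, ∑ a, p a * (w a i * w a j) = if i = j then 1 else 0 := by
    intro i j
    cases i using Fin.cases <;> cases j using Fin.cases <;>
      simp [hw0, hws, hpsum, hcent, ← mul_assoc, hnorm, Fin.succ_ne_zero,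
        (Fin.succ_ne_zero _).symm]
  have hmul : ∀ a i j, w a i * w a j = ∑ m, Text i j m * w a m := by
    intro a i j
    cases i using Fin.cases with
    | zero => simp [hText2, hw0]
    | succ i =>
      cases j using Fin.cases with
      | zero => simp [hText1, hw0]
      | succ j => simp [Fin.sum_univ_succ, hw0, hws, hText0, hTexts, hT]
  have hsymm : ∀ i j k, Text i j k = Text i k j := fun i j k => by
    rw [structureTensor_eq_thirdMoment horth hmul, structureTensor_eq_thirdMoment horth hmul]
    exact Finset.sum_congr rfl fun a _ => by ring
  intro l
  have hwl : w l ≠ 0 := fun h => by simpa [hw0] using congrFun h 0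
  refine mem_unitaryGroup_of_block_eigenvector hwl hU1 fun i => ?_
  simp only [hU, Finset.smul_sum, smul_smul]
  rw [Finset.sum_comm]
  refine Finset.sum_congr rfl fun k _ => ?_
  rw [← Finset.sum_smul]
  congr 1
  rw [← Complex.ofReal_mul, hmul l i k]
  push_cast
  exact Finset.sum_congr rfl fun j _ => by rw [hsymm i j k, mul_comm]
end
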